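/- arXiv:2308.13361 — 2 statements merged into one kernel-verified Lean document; each statement's English description precedes it below -/
import Mathlib

section
/- Let p ∈ [1,∞), suppose X is internally doubling and supports an internal p-Poincaré inequality. Let Ω ⊆ X be open, (Y,d_Y) a metric space, and f ∈ 𝔅(Ω,Y) with E_p[f](Ω) < ∞. Then for every Borel set E ⋐ Ω, the restriction f|_E has the Luzin–Lipschitz property: there exist Borel sets E_m ⊆ E, m ∈ ℕ, with m(E \ ⋃_m E_m) = 0 such that f|_{E_m} is Lipschitz for every m. -/
open MeasureTheory Filter Metric Set Topology
open scoped ENNReal NNReal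

noncomputable section

namespace BBM

variable {X : Type*} [MetricSpace X]

/-- The closed `r`-neighborhood of a set `S`: the set of points at distance at most `r`
from `S`. -/
def setBall (S : Set X) (r : ℝ) : Set X :=
  {x : X | EMetric.infEdist x S ≤ ENNReal.ofReal r}

/-- The (extended) distance, computed in the metric completion `X̄` of `X`, from a set
`S ⊆ X` to the complement `X̄ \ S₀` of a set `S₀ ⊆ X`. -/
def compDist (S S₀ : Set X) : ℝ≥0∞ :=
  ⨅ (x : X) (_ : x ∈ S) (z : UniformSpace.Completion X)
    (_ : z ∉ (fun a : X => (a : UniformSpace.Completion X)) '' S₀),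
    edist (x : UniformSpace.Completion X) z

/-- `S ⋐ S₀` : the set `S` is well contained in `S₀`, i.e. `S ⊆ S₀` and the distance
from `S` to `X̄ \ S₀` (computed in the completion `X̄`) is positive. -/
def WellInside (S S₀ : Set X) : Prop := S ⊆ S₀ ∧ 0 < compDist S S₀

/-- The local Lipschitz constant (slope) of `u` at `x`, relative to the domain `Ω`.
If `x` is not a limit point of `Ω`, the filter below is trivial and the value is `0`. -/
def lipAt (Ω : Set X) (u : X → ℝ) (x : X) : ℝ≥0∞ :=
  Filter.limsup (fun x' => ENNReal.ofReal (|u x' - u x| / dist x' x)) (𝓝[Ω \ {x}] x)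

/-- `u` is locally Lipschitz on `Ω`: each point of `Ω` has a closed ball inside `Ω`
on which `u` is Lipschitz. -/
def LocLipschitzOn (Ω : Set X) (u : X → ℝ) : Prop :=
  ∀ x ∈ Ω, ∃ r > 0, ∃ K : NNReal, closedBall x r ⊆ Ω ∧ LipschitzOnWith K u (closedBall x r)

variable [MeasurableSpace X]

/-- `u ∈ L^p_loc(E)` : `u` is Borel and `p`-integrable near every point of `E`. -/
def MemLpLocOn (m : Measure X) (p : ℝ) (E : Set X) (u : X → ℝ) : Prop :=
  Measurable u ∧ ∀ x ∈ E, ∃ r > 0,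
    ∫⁻ x' in E ∩ closedBall x r, ENNReal.ofReal |u x'| ^ p ∂m < ⊤

/-- Convergence of a sequence `v n` to `u` in `L^p_loc(E)`. -/
def TendstoLpLoc (m : Measure X) (p : ℝ) (E : Set X) (v : ℕ → X → ℝ) (u : X → ℝ) : Prop :=
  ∀ x ∈ E, ∃ r > 0,
    Tendsto (fun n => ∫⁻ x' in E ∩ closedBall x r, ENNReal.ofReal |v n x' - u x'| ^ p ∂m)
      atTop (𝓝 0)

/-- Cheeger `p`-energy of a real valued function on an open set `Ω'`, defined by relaxation
along sequences of locally Lipschitz functions converging in `L^p_loc(Ω')`. -/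
def cheegerOpen (m : Measure X) (p : ℝ) (u : X → ℝ) (Ω' : Set X) : ℝ≥0∞ :=
  ⨅ (v : ℕ → X → ℝ) (_ : ∀ n, LocLipschitzOn Ω' (v n)) (_ : TendstoLpLoc m p Ω' v u),
    Filter.liminf (fun n => ∫⁻ x in Ω', lipAt Ω' (v n) x ^ p ∂m) atTop

/-- Cheeger `p`-energy of a real valued function on an arbitrary subset `S` of `Ω`:
infimum over open sets `Ω'` with `S ⊆ Ω' ⊆ Ω`. -/
def cheegerSet (m : Measure X) (p : ℝ) (Ω : Set X) (u : X → ℝ) (S : Set X) : ℝ≥0∞ :=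
  ⨅ (Ω' : Set X) (_ : IsOpen Ω') (_ : Ω' ⊆ Ω) (_ : S ⊆ Ω'), cheegerOpen m p u Ω'

/-- `φ` is a bounded `1`-Lipschitz real function. -/
def BddLip1 {Y : Type*} [PseudoMetricSpace Y] (φ : Y → ℝ) : Prop :=
  (∃ C, ∀ y, |φ y| ≤ C) ∧ LipschitzWith 1 φ

/-- `ν` is a Borel-regular outer measure: Borel sets are Carathéodory-measurable and every
set is contained in a Borel set with the same measure. -/
def IsBorelRegularOM (ν : OuterMeasure X) : Prop :=
  (∀ B : Set X, MeasurableSet B → ν.IsCaratheodory B) ∧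
  ∀ S : Set X, ∃ B : Set X, MeasurableSet B ∧ S ⊆ B ∧ ν S = ν B

/-- `ν` is the Cheeger `p`-energy of the metric-space-valued map `f` on `Ω`: the least
Borel-regular outer measure dominating `S ↦ E_p[φ ∘ f](S)` for all bounded `1`-Lipschitz
`φ : Y → ℝ` and all `S ⊆ Ω`. -/
def IsCheegerEnergy (m : Measure X) (p : ℝ) (Ω : Set X) {Y : Type*} [MetricSpace Y]
    (f : X → Y) (ν : OuterMeasure X) : Prop :=
  IsBorelRegularOM ν ∧
  (∀ S, S ⊆ Ω → ∀ φ : Y → ℝ, BddLip1 φ → cheegerSet m p Ω (φ ∘ f) S ≤ ν S) ∧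
  ∀ ν' : OuterMeasure X, IsBorelRegularOM ν' →
    (∀ S, S ⊆ Ω → ∀ φ : Y → ℝ, BddLip1 φ → cheegerSet m p Ω (φ ∘ f) S ≤ ν' S) →
    ∀ S, S ⊆ Ω → ν S ≤ ν' S

/-- `f ∈ 𝔅(E, Y)` : `f` is Borel (w.r.t. the Borel σ-algebra of `Y`) on `E` and essentially
separably valued on `E`. -/
def MemB (m : Measure X) (E : Set X) {Y : Type*} [MetricSpace Y] (f : X → Y) : Prop :=
  (@Measurable E Y _ (borel Y) fun x : E => f x) ∧
  ∃ N : Set X, N ⊆ E ∧ m N = 0 ∧ TopologicalSpace.IsSeparable (f '' (E \ N))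

/-- `f ∈ L^p(E, Y)`. -/
def MemLpY (m : Measure X) (p : ℝ) (E : Set X) {Y : Type*} [MetricSpace Y] (f : X → Y) :
    Prop :=
  MemB m E f ∧ ∃ y : Y, ∫⁻ x in E, edist (f x) y ^ p ∂m < ⊤

/-- `f ∈ L^p_loc(E, Y)`. -/
def MemLpLocY (m : Measure X) (p : ℝ) (E : Set X) {Y : Type*} [MetricSpace Y] (f : X → Y) :
    Prop :=
  MemB m E f ∧ ∃ y : Y, ∀ x ∈ E, ∃ r > 0,
    ∫⁻ x' in E ∩ closedBall x r, edist (f x') y ^ p ∂m < ⊤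

/-- `f ∈ S^{1,p}(Ω, Y)` : `f ∈ 𝔅(Ω,Y)`, the Cheeger `p`-energy of `f` is finite on `Ω` and
absolutely continuous with respect to `m` restricted to `Ω`. -/
def MemSobolevClass (m : Measure X) (p : ℝ) (Ω : Set X) {Y : Type*} [MetricSpace Y]
    (f : X → Y) : Prop :=
  MemB m Ω f ∧ ∃ ν : OuterMeasure X, IsCheegerEnergy m p Ω f ν ∧ ν Ω < ⊤ ∧
    ∀ S, S ⊆ Ω → m S = 0 → ν S = 0

/-- The doubling property on the `R`-neighborhood of `S`, at scales up to `R`. -/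
def DoublingOn (m : Measure X) (C_D : NNReal) (S : Set X) (R : ℝ) : Prop :=
  ∀ x ∈ setBall S R, ∀ r : ℝ, 0 < r → r ≤ R →
    0 < m (closedBall x (2 * r)) ∧
    m (closedBall x (2 * r)) ≤ (C_D : ℝ≥0∞) * m (closedBall x r) ∧
    m (closedBall x r) < ⊤

/-- `X` is internally doubling with constant `C_D`. -/
def InternallyDoubling (m : Measure X) (C_D : NNReal) : Prop :=
  1 ≤ C_D ∧ ∀ S : Set X, WellInside S univ → ∃ R > 0, DoublingOn m C_D S R

/-- The `p`-Poincaré property on the `R`-neighborhood of `S`, at scales up to `R`. -/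
def PoincareOn (m : Measure X) (p C_P lam : ℝ) (S : Set X) (R : ℝ) : Prop :=
  (∀ x ∈ setBall S R, ∀ r : ℝ, 0 < r → r ≤ lam * R →
      0 < m (closedBall x r) ∧ m (closedBall x r) < ⊤) ∧
  ∀ u : X → ℝ, (∃ K : NNReal, LipschitzWith K u) →
    ∀ x ∈ setBall S R, ∀ r : ℝ, 0 < r → r ≤ R →
      (m (closedBall x r))⁻¹ *
          ∫⁻ x' in closedBall x r,
            ENNReal.ofReal |u x' - ⨍ x'' in closedBall x r, u x'' ∂m| ∂m ≤
        ENNReal.ofReal (C_P * r) *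
          ((m (closedBall x (lam * r)))⁻¹ *
              ∫⁻ x' in closedBall x (lam * r), lipAt univ u x' ^ p ∂m) ^ (1 / p)

/-- `X` supports an internal `p`-Poincaré inequality with constants `C_P`, `lam`. -/
def InternalPoincare (m : Measure X) (p C_P lam : ℝ) : Prop :=
  0 < C_P ∧ 1 ≤ lam ∧ ∀ S : Set X, WellInside S univ → ∃ R > 0, PoincareOn m p C_P lam S R

/-- `σ(δ, x, r)` : supremum of `ρ δ x ·` outside the closed ball `B(x,r)` (zero if the
complement is empty). -/
def sigmaM (ρ : ℝ → X → X → NNReal) (δ : ℝ) (x : X) (r : ℝ) : ℝ≥0∞ :=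
  ⨆ x' ∈ (closedBall x r)ᶜ, (ρ δ x x' : ℝ≥0∞)

/-- Absolute difference in `ℝ≥0∞`. -/
def eabs (a b : ℝ≥0∞) : ℝ≥0∞ := (a - b) ⊔ (b - a)

/-- The quantities `Π_{L,k}(δ,x,r,h)`. -/
def PiL (m : Measure X) (ρ : ℝ → X → X → NNReal) (p δ : ℝ) (x : X) (r h : ℝ) : ℕ → ℝ≥0∞
  | 0 => sigmaM ρ δ x r * m (closedBall x (r / h)) * ENNReal.ofReal (r / h) ^ p
  | k + 1 =>
      eabs (sigmaM ρ δ x (r / h ^ (k + 1))) (sigmaM ρ δ x (r / h ^ k)) *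
        m (closedBall x (r / h ^ (k + 2))) * ENNReal.ofReal (r / h ^ (k + 2)) ^ p

/-- The quantities `Π_{U,k}(δ,x,r,h)`. -/
def PiU (m : Measure X) (ρ : ℝ → X → X → NNReal) (p δ : ℝ) (x : X) (r h : ℝ) : ℕ → ℝ≥0∞
  | 0 => sigmaM ρ δ x r * m (closedBall x r) * ENNReal.ofReal r ^ p
  | k + 1 =>
      eabs (sigmaM ρ δ x (r / h ^ (k + 1))) (sigmaM ρ δ x (r / h ^ k)) *
        m (closedBall x (r / h ^ (k + 1))) * ENNReal.ofReal (r / h ^ (k + 1)) ^ p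

/-- The family `(ρ_δ)_{δ ∈ (0,1)}` is `p`-admissible with constant `C_M`. -/
def PAdmissible (m : Measure X) (p : ℝ) (ρ : ℝ → X → X → NNReal) (C_M : NNReal) : Prop :=
  (∀ δ ∈ Ioo (0:ℝ) 1, Measurable fun q : X × X => ρ δ q.1 q.2) ∧
  (Filter.limsup (fun r : ℝ => Filter.limsup (fun δ : ℝ =>
      ⨆ x : X, ∫⁻ x' in (closedBall x r)ᶜ, ((ρ δ x x' : ℝ≥0∞) + (ρ δ x' x : ℝ≥0∞)) ∂m)
      (𝓝[>] (0:ℝ))) (𝓝[>] (0:ℝ)) = 0) ∧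
  (∀ x : X, Filter.limsup (fun r : ℝ => Filter.limsup (fun δ : ℝ => sigmaM ρ δ x r)
      (𝓝[>] (0:ℝ))) (𝓝[>] (0:ℝ)) = 0) ∧
  (∀ δ ∈ Ioo (0:ℝ) 1, ∀ x x₁ x₂ : X, dist x x₁ ≤ dist x x₂ → ρ δ x x₂ ≤ ρ δ x x₁) ∧
  (∀ x : X, ∀ δ ∈ Ioo (0:ℝ) 1,
      Filter.limsup (fun r : ℝ => sigmaM ρ δ x r * m (closedBall x r) * ENNReal.ofReal r ^ p)
        (𝓝[>] (0:ℝ)) = 0) ∧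
  1 ≤ C_M ∧
  ∀ S : Set X, S.Nonempty → WellInside S univ →
    ((C_M : ℝ≥0∞))⁻¹ ≤ Filter.liminf (fun r : ℝ => Filter.liminf (fun δ : ℝ =>
        ∑' k, ⨅ x ∈ S, PiL m ρ p δ x r 2 k) (𝓝[>] (0:ℝ))) (𝓝[>] (0:ℝ)) ∧
    Filter.limsup (fun r : ℝ => Filter.limsup (fun δ : ℝ =>
        ∑' k, ⨆ x ∈ S, PiU m ρ p δ x r 2 k) (𝓝[>] (0:ℝ))) (𝓝[>] (0:ℝ)) ≤ (C_M : ℝ≥0∞)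

/-- The family `(ρ_δ)_{δ ∈ (0,1)}` is strongly `p`-admissible with constant `C_M` and
function `Θ`. -/
def StronglyPAdmissible (m : Measure X) (p : ℝ) (ρ : ℝ → X → X → NNReal) (C_M : NNReal)
    (Θ : X → ℝ≥0∞) : Prop :=
  PAdmissible m p ρ C_M ∧
  (∀ S : Set X, S.Nonempty → WellInside S univ → ∀ h : ℝ, 1 < h →
      Filter.limsup (fun r : ℝ => Filter.limsup (fun δ : ℝ =>
          ∑' k, ⨆ x ∈ S, PiU m ρ p δ x r h k) (𝓝[>] (0:ℝ))) (𝓝[>] (0:ℝ)) < ⊤) ∧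
  Measurable Θ ∧ (∀ x, Θ x < ⊤) ∧
  Filter.limsup (fun h : ℝ => essSup (fun x : X =>
      Filter.limsup (fun r : ℝ => Filter.limsup (fun δ : ℝ =>
          eabs (Θ x) (∑' k, PiL m ρ p δ x r h k) + eabs (Θ x) (∑' k, PiU m ρ p δ x r h k))
        (𝓝[>] (0:ℝ))) (𝓝[>] (0:ℝ))) m) (𝓝[>] (1:ℝ)) = 0

/-- The Korevaar–Schoen approximate `p`-energy density `ks_p[f,E](x,r)`. -/
def ks (m : Measure X) (p : ℝ) {Y : Type*} [PseudoEMetricSpace Y] (f : X → Y) (E : Set X)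
    (x : X) (r : ℝ) : ℝ≥0∞ :=
  (m (closedBall x r))⁻¹ *
    ∫⁻ x' in closedBall x r ∩ E, edist (f x) (f x') ^ p / ENNReal.ofReal r ^ p ∂m

/-- The averaging operator `A_p[f](x,r)` applied to an energy (outer) measure `ν`. -/
def Aop (m : Measure X) (ν : OuterMeasure X) (x : X) (r : ℝ) : ℝ≥0∞ :=
  if m (closedBall x r) = 0 then 0 else ν (closedBall x r) / m (closedBall x r)

/-- The (modified) Riesz potential `R_p[f](x,r)` applied to an energy measure `ν`. -/
def Rop (m : Measure X) (ν : OuterMeasure X) (x : X) (r : ℝ) : ℝ≥0∞ :=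
  (3 : ℝ≥0∞)⁻¹ * ∑' k : ℕ, (2 / 3 : ℝ≥0∞) ^ k * Aop m ν x (r / 2 ^ k)

/-- The maximal function `M_p[f](x,r)` applied to an energy measure `ν`. -/
def Mop (m : Measure X) (ν : OuterMeasure X) (x : X) (r : ℝ) : ℝ≥0∞ :=
  ⨆ r' ∈ Ioc (0:ℝ) r, Aop m ν x r'

/-- `x` is a density point of `E` (and lies in the support of `m`). -/
def IsDensityPoint (m : Measure X) (E : Set X) (x : X) : Prop :=
  (∀ r : ℝ, 0 < r → 0 < m (ball x r)) ∧
  Tendsto (fun r : ℝ => m (E ∩ closedBall x r) / m (closedBall x r)) (𝓝[>] (0:ℝ)) (𝓝 1)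

/-- `f` has the Luzin–Lipschitz property on `E`. -/
def LuzinLipschitzOn (m : Measure X) (E : Set X) {Y : Type*} [PseudoEMetricSpace Y]
    (f : X → Y) : Prop :=
  ∃ E' : ℕ → Set X, (∀ k, MeasurableSet (E' k) ∧ E' k ⊆ E) ∧ m (E \ ⋃ k, E' k) = 0 ∧
    ∀ k, ∃ K : NNReal, LipschitzOnWith K f (E' k)

/-- A strongly rectifiable atlas with accuracy `ε`: pieces `U i`, dimensions `d i`,
`(1+ε)`-biLipschitz charts `ψ i`, and pushforward measures equal to `c i · θ i · Lebesgue`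
on the chart images. -/
def RectAtlas (m : Measure X) (ε : ℝ) (d : ℕ → ℕ) (U : ℕ → Set X)
    (ψ : (i : ℕ) → X → EuclideanSpace ℝ (Fin (d i))) (c : ℕ → ℝ)
    (θ : (i : ℕ) → EuclideanSpace ℝ (Fin (d i)) → ℝ) : Prop :=
  (∀ i, MeasurableSet (U i)) ∧ Pairwise (Function.onFun Disjoint U) ∧
  m (Set.univ \ ⋃ i, U i) = 0 ∧
  (∀ i, ∀ x ∈ U i, ∀ y ∈ U i,
      dist x y ≤ (1 + ε) * dist (ψ i x) (ψ i y) ∧ dist (ψ i x) (ψ i y) ≤ (1 + ε) * dist x y) ∧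
  (∀ i, 0 < c i) ∧ (∀ i, Measurable (θ i)) ∧ (∀ i v, θ i v ∈ Set.Icc (1 + ε)⁻¹ (1 + ε)) ∧
  ∀ i, ∀ A : Set (EuclideanSpace ℝ (Fin (d i))), MeasurableSet A →
    m (U i ∩ ψ i ⁻¹' A) = ∫⁻ v in A ∩ ψ i '' U i, ENNReal.ofReal (c i * θ i v)

/-- `X` (with measure `m`) is strongly rectifiable. -/
def StronglyRectifiable (m : Measure X) : Prop :=
  ∀ ε ∈ Ioo (0:ℝ) 1, ∃ d U ψ c θ, RectAtlas m ε d U ψ c θ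

/-- `Dim` is a dimensional decomposition function for the strongly rectifiable space `X`. -/
def IsDimensionFunction (m : Measure X) (Dim : X → ℕ) : Prop :=
  Measurable Dim ∧ ∀ ε ∈ Ioo (0:ℝ) 1, ∃ d U ψ c θ, RectAtlas m ε d U ψ c θ ∧
    ∀ i, m {x ∈ U i | Dim x ≠ d i} = 0

/-- The data of a good extension: `ι` is an isometric embedding of `Y` into `Z` and
`F ∈ L^p(X, Z)` has finite Cheeger `p`-energy `ν` on `X`, coincides `m`-a.e. on `Ω`
with `ι ∘ f`, and `E_p[F](B(Ω,r)) → E_p[F](Ω)` as `r ↘ 0`. -/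
def IsGoodExtension (m : Measure X) (p : ℝ) (Ω : Set X) {Y : Type*} [MetricSpace Y]
    {Z : Type*} [MetricSpace Z] (f : X → Y) (ι : Y → Z) (F : X → Z) : Prop :=
  Isometry ι ∧ MemLpY m p Set.univ F ∧
  ∃ ν : OuterMeasure X, IsCheegerEnergy m p Set.univ F ν ∧ ν Set.univ < ⊤ ∧
    (∀ᵐ x ∂m.restrict Ω, F x = ι (f x)) ∧
    Tendsto (fun r : ℝ => ν (setBall Ω r)) (𝓝[>] (0:ℝ)) (𝓝 (ν Ω))

/-- The open set `Ω` has the strong `p`-extension property. -/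
def StrongPExtension (m : Measure X) (p : ℝ) (Ω : Set X) : Prop :=
  ∀ (Y : Type) [MetricSpace Y] (f : X → Y),
    MemLpY m p Ω f → (∃ ν : OuterMeasure X, IsCheegerEnergy m p Ω f ν ∧ ν Ω < ⊤) →
    ∃ (Z : Type) (iZ : MetricSpace Z) (ι : Y → Z) (F : X → Z),
      @IsGoodExtension X _ _ m p Ω Y _ Z iZ f ι F

theorem wellInside_singleton {X : Type*} [MetricSpace X]
    (hloc : ∀ x : X, ∃ r > 0, IsComplete (closedBall x r)) (x : X) :
    WellInside ({x} : Set X) univ := by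
  obtain ⟨r, hr, hc⟩ := hloc x
  refine ⟨subset_univ _, ?_⟩
  refine lt_of_lt_of_le (ENNReal.ofReal_pos.2 hr) ?_
  unfold compDist
  refine le_iInf fun y => le_iInf fun hy => le_iInf fun z => le_iInf fun hz => ?_
  rw [mem_singleton_iff] at hy
  subst hy
  by_contra hlt
  push Not at hlt
  apply hz
  have hzb : z ∈ Metric.eball (y : UniformSpace.Completion X) (ENNReal.ofReal r) := by
    rw [Metric.mem_eball, edist_comm]; exact hlt
  have hcl : IsClosed ((fun a : X => (a : UniformSpace.Completion X)) '' closedBall y r) := by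
    have : IsComplete ((fun a : X => (a : UniformSpace.Completion X)) '' closedBall y r) :=
      (UniformSpace.Completion.isUniformInducing_coe X).isComplete_iff.2 hc
    exact this.isClosed
  have hd : DenseRange (fun a : X => (a : UniformSpace.Completion X)) :=
    UniformSpace.Completion.denseRange_coe
  have h1 := Dense.open_subset_closure_inter (s := range (fun a : X =>
    (a : UniformSpace.Completion X))) hd (t := Metric.eball (y : UniformSpace.Completion X)
    (ENNReal.ofReal r)) Metric.isOpen_eball hzb
  have h2 : closure (Metric.eball (y : UniformSpace.Completion X)
    (ENNReal.ofReal r) ∩ range (fun a : X => (a : UniformSpace.Completion X))) ⊆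
      (fun a : X => (a : UniformSpace.Completion X)) '' closedBall y r := by
    refine closure_minimal ?_ hcl
    rintro _ ⟨hw, w, rfl⟩
    refine ⟨w, ?_, rfl⟩
    rw [Metric.mem_eball, UniformSpace.Completion.edist_eq, edist_lt_ofReal] at hw
    exact hw.le
  exact image_mono (subset_univ _) (h2 h1)

theorem mem_setBall_singleton {X : Type*} [MetricSpace X] {x y : X} {R : ℝ}
    (h : dist y x ≤ R) : y ∈ setBall {x} R := by
  unfold setBall
  change Metric.infEDist y {x} ≤ _
  rw [Metric.infEDist_singleton, edist_dist]
  exact ENNReal.ofReal_le_ofReal h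

theorem totallyBounded_of_doubling {X : Type*} [MetricSpace X] [MeasurableSpace X] [BorelSpace X]
    (m : Measure X) (C : ℝ≥0) (x : X) (R : ℝ) (hR : 0 < R) (h : DoublingOn m C {x} R) :
    TotallyBounded (closedBall x (R / 8)) := by
  have key : ∀ z ∈ closedBall x (R / 8), ∀ n : ℕ,
      m (closedBall z R) ≤ (C : ℝ≥0∞) ^ n * m (closedBall z (R / 2 ^ n)) := by
    intro z hz n
    induction n with
    | zero => simp
    | succ n ih =>
      have h1 := (h z (mem_setBall_singleton (hz.trans (by linarith))) (R / 2 ^ (n + 1))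
        (by positivity) (div_le_self hR.le (one_le_pow₀ (by norm_num)))).2.1
      have h2 : 2 * (R / 2 ^ (n + 1)) = R / 2 ^ n := by rw [pow_succ]; field_simp
      rw [h2] at h1
      calc _ ≤ _ := ih
        _ ≤ (C : ℝ≥0∞) ^ n * (C * m (closedBall z (R / 2 ^ (n + 1)))) := by gcongr
        _ = _ := by rw [← mul_assoc, ← pow_succ]
  have hx := h x (mem_setBall_singleton (by simpa using hR.le)) R hR le_rfl
  have hx4 := (h x (mem_setBall_singleton (by simpa using hR.le)) (R / 4) (by linarith)
    (by linarith)).1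
  rw [Metric.totallyBounded_iff]
  intro ε hε
  obtain ⟨n, hn⟩ : ∃ n : ℕ, R / 2 ^ n < min (ε / 5) (R / 8) := by
    have : Tendsto (fun n : ℕ => R * (1 / 2 : ℝ) ^ n) atTop (𝓝 (R * 0)) :=
      (tendsto_pow_atTop_nhds_zero_of_lt_one (by norm_num) (by norm_num)).const_mul R
    rw [mul_zero] at this
    obtain ⟨n, hn⟩ := (this.eventually (gt_mem_nhds (show (0:ℝ) < min (ε / 5) (R / 8) by
        positivity))).exists
    exact ⟨n, by simpa [div_eq_mul_inv] using hn⟩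
  set s := R / 2 ^ n with hs
  have hspos : 0 < s := by positivity
  obtain ⟨u, hut, hud, huc⟩ := Vitali.exists_disjoint_subfamily_covering_enlargement_closedBall
    (closedBall x (R / 8)) (fun z : X => z) (fun _ => s) s (fun _ _ => le_rfl)
    5 (by norm_num)
  have hufin : u.Finite := by
    set c : ℝ≥0∞ := m (closedBall x (R / 2)) / ((C : ℝ≥0∞) ^ n + 1) with hc
    have hcpos : 0 < c := by
      rw [hc]
      refine ENNReal.div_pos ?_ (by finiteness)
      have : 2 * (R / 4) = R / 2 := by ring
      rw [this] at hx4
      exact hx4.ne'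
    have := Measure.finite_const_le_meas_of_disjoint_iUnion m (ε := c) hcpos
      (As := fun z : u => closedBall (z : X) s) (fun _ => isClosed_closedBall.measurableSet)
      (fun a b hab => hud a.2 b.2 (fun h => hab (Subtype.ext h)))
      (ne_top_of_le_ne_top hx.2.2.ne (measure_mono (by
        refine iUnion_subset fun z => ?_
        refine closedBall_subset_closedBall' ?_
        have h1 := hut z.2
        rw [mem_closedBall] at h1
        have := hn.trans_le (min_le_right _ _)
        linarith)))
    have huniv : {i : u | c ≤ m (closedBall (i : X) s)} = univ := by
      ext z
      simp only [mem_ofPred_eq, mem_univ, iff_true]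
      rw [hc]
      refine ENNReal.div_le_of_le_mul' ?_
      calc m (closedBall x (R / 2)) ≤ m (closedBall (z : X) R) := by
            refine measure_mono (closedBall_subset_closedBall' ?_)
            have h1 := hut z.2
            rw [mem_closedBall, dist_comm] at h1
            linarith
        _ ≤ _ := key z (hut z.2) n
        _ ≤ _ := by gcongr; exact le_self_add
    rw [huniv] at this
    exact Set.finite_coe_iff.1 (Set.finite_univ_iff.1 this)
  refine ⟨u, hufin, fun z hz => ?_⟩
  obtain ⟨b, hb, hzb⟩ := huc z hz
  rw [mem_iUnion₂]
  refine ⟨b, hb, ?_⟩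
  have h1 := hzb (mem_closedBall_self hspos.le)
  rw [mem_closedBall] at h1
  rw [mem_ball]
  have := hn.trans_le (min_le_left _ _)
  linarith

theorem ofReal_abs_average_le {X : Type*} [MeasurableSpace X] (m : Measure X) (B : Set X)
    (g : X → ℝ) :
    ENNReal.ofReal |⨍ x in B, g x ∂m| ≤ (m B)⁻¹ * ∫⁻ x in B, ENNReal.ofReal |g x| ∂m := by
  rw [setAverage_eq, smul_eq_mul, abs_mul, ENNReal.ofReal_mul (abs_nonneg _)]
  have h1 : ENNReal.ofReal |(m.real B)⁻¹| ≤ (m B)⁻¹ := by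
    rw [abs_of_nonneg (by positivity), Measure.real, ← ENNReal.toReal_inv]
    exact ENNReal.ofReal_toReal_le
  have h2 : ENNReal.ofReal |∫ x in B, g x ∂m| ≤ ∫⁻ x in B, ENNReal.ofReal |g x| ∂m := by
    simp_rw [← Real.enorm_eq_ofReal_abs]
    exact enorm_integral_le_lintegral_enorm _
  exact mul_le_mul' h1 h2

theorem lipAt_congr {X : Type*} [MetricSpace X] {Ω U : Set X} (hU : IsOpen U) (hUΩ : U ⊆ Ω)
    {v w : X → ℝ} (h : EqOn v w U) {x : X} (hx : x ∈ U) : lipAt univ w x = lipAt Ω v x := by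
  unfold lipAt
  have hf : 𝓝[univ \ {x}] x = 𝓝[Ω \ {x}] x := by
    refine nhdsWithin_eq_nhdsWithin hx hU ?_
    ext z
    simp only [mem_inter_iff, Set.mem_sdiff, mem_univ, true_and]
    exact ⟨fun hz => ⟨⟨hUΩ hz.2, hz.1⟩, hz.2⟩, fun hz => ⟨hz.1.2, hz.2⟩⟩
  rw [hf]
  refine limsup_congr ?_
  filter_upwards [mem_nhdsWithin_of_mem_nhds (hU.mem_nhds hx)] with z hz
  rw [h hz, h hx]

theorem tendsto_Lp_compact {X : Type*} [MetricSpace X] [MeasurableSpace X]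
    (m : Measure X) (p : ℝ) (Ω K : Set X) (hK : IsCompact K) (hKΩ : K ⊆ Ω) (hΩ : IsOpen Ω)
    (v : ℕ → X → ℝ) (u : X → ℝ) (h : TendstoLpLoc m p Ω v u) :
    Tendsto (fun n => ∫⁻ x' in K, ENNReal.ofReal |v n x' - u x'| ^ p ∂m) atTop (𝓝 0) := by
  refine hK.induction_on (p := fun s => Tendsto
    (fun n => ∫⁻ x' in s, ENNReal.ofReal |v n x' - u x'| ^ p ∂m) atTop (𝓝 0)) ?_ ?_ ?_ ?_
  · simp
  · intro s t hst ht
    exact tendsto_of_tendsto_of_tendsto_of_le_of_le tendsto_const_nhds ht (fun _ => zero_le)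
      (fun n => lintegral_mono_set hst)
  · intro s t hs ht
    have := hs.add ht
    rw [add_zero] at this
    exact tendsto_of_tendsto_of_tendsto_of_le_of_le tendsto_const_nhds this (fun _ => zero_le)
      (fun n => lintegral_union_le _ _ _)
  · intro x hx
    obtain ⟨r, hr, hT⟩ := h x (hKΩ hx)
    exact ⟨Ω ∩ closedBall x r, mem_nhdsWithin_of_mem_nhds
      (inter_mem (hΩ.mem_nhds (hKΩ hx)) (closedBall_mem_nhds x hr)), hT⟩

theorem lintegral_le_rpow {X : Type*} [MeasurableSpace X] (μ : Measure X) (p : ℝ) (hp : 1 ≤ p)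
    (g : X → ℝ) (hg : AEStronglyMeasurable g μ) :
    ∫⁻ x, ENNReal.ofReal |g x| ∂μ ≤
      (∫⁻ x, ENNReal.ofReal |g x| ^ p ∂μ) ^ (1 / p) * μ univ ^ (1 - 1 / p) := by
  have h := eLpNorm_le_eLpNorm_mul_rpow_measure_univ (p := 1) (q := ENNReal.ofReal p) (μ := μ)
    (f := g) (by simpa using hp) hg
  rw [eLpNorm_one_eq_lintegral_enorm, eLpNorm_eq_lintegral_rpow_enorm_toReal
    (by simp; linarith) ENNReal.ofReal_ne_top, ENNReal.toReal_ofReal (by linarith)] at h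
  simpa [Real.enorm_eq_ofReal_abs] using h

theorem poincare_relaxed {X : Type*} [MetricSpace X] [MeasurableSpace X] [BorelSpace X]
    [SecondCountableTopology X]
    (m : Measure X) [IsLocallyFiniteMeasure m] (p : ℝ) (hp : 1 ≤ p) (CP lam : ℝ) (hlam : 1 ≤ lam)
    (x : X) (r : ℝ) (hr : 0 < r)
    (hPI : ∀ u : X → ℝ, (∃ K : NNReal, LipschitzWith K u) →
      (m (closedBall x r))⁻¹ *
          ∫⁻ x' in closedBall x r,
            ENNReal.ofReal |u x' - ⨍ x'' in closedBall x r, u x'' ∂m| ∂m ≤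
        ENNReal.ofReal (CP * r) *
          ((m (closedBall x (lam * r)))⁻¹ *
              ∫⁻ x' in closedBall x (lam * r), lipAt univ u x' ^ p ∂m) ^ (1 / p))
    (hK : IsCompact (closedBall x (2 * (lam * r)))) (hm0 : 0 < m (closedBall x r))
    (hmt : m (closedBall x r) < ⊤)
    (Ω' : Set X) (hΩ' : IsOpen Ω') (hsub : closedBall x (2 * (lam * r)) ⊆ Ω')
    (v : ℕ → X → ℝ) (hv : ∀ n, LocLipschitzOn Ω' (v n))
    (u : X → ℝ) (hu : Measurable u) (hub : ∃ C, ∀ x, |u x| ≤ C)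
    (htend : TendstoLpLoc m p Ω' v u) (L : ℝ≥0∞)
    (hL : liminf (fun n => ∫⁻ x in Ω', lipAt Ω' (v n) x ^ p ∂m) atTop < L) :
    (m (closedBall x r))⁻¹ *
          ∫⁻ x' in closedBall x r,
            ENNReal.ofReal |u x' - ⨍ x'' in closedBall x r, u x'' ∂m| ∂m ≤
        ENNReal.ofReal (CP * r) * ((m (closedBall x (lam * r)))⁻¹ * L) ^ (1 / p) := by
  have hlr : r ≤ lam * r := by nlinarith
  have hp0 : 0 < p := by linarith
  set B := closedBall x r with hB
  set K := closedBall x (2 * (lam * r)) with hKdef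
  have hBK : B ⊆ K := closedBall_subset_closedBall (by linarith)
  have hBc : IsCompact B := hK.of_isClosed_subset isClosed_closedBall hBK
  have hex : ∀ n, ∃ w : X → ℝ, (∃ k : ℝ≥0, LipschitzWith k w) ∧ EqOn (v n) w K := by
    intro n
    have hll : LocallyLipschitzOn K (v n) := by
      intro z hz
      obtain ⟨s, hs, k, _, hk⟩ := hv n z (hsub hz)
      exact ⟨k, closedBall z s, mem_nhdsWithin_of_mem_nhds (closedBall_mem_nhds z hs), hk⟩
    obtain ⟨k, hk⟩ := hll.exists_lipschitzOnWith_of_compact hK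
    obtain ⟨w, hw, he⟩ := hk.extend_real
    exact ⟨w, ⟨k, hw⟩, he⟩
  choose w hw hvw using hex
  have hwc : ∀ n, Continuous (w n) := fun n => by
    obtain ⟨k, hk⟩ := hw n
    exact hk.continuous
  have hfinB : IsFiniteMeasure (m.restrict B) := ⟨by simpa using hmt⟩
  set e : ℕ → ℝ≥0∞ := fun n => ∫⁻ y in B, ENNReal.ofReal |w n y - u y| ∂m with he
  have he0 : Tendsto e atTop (𝓝 0) := by
    have h1 := tendsto_Lp_compact m p Ω' K hK hsub hΩ' v u htend
    have h2 : Tendsto (fun n => (∫⁻ x' in K, ENNReal.ofReal |v n x' - u x'| ^ p ∂m) ^ (1 / p) *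
        (m.restrict B) univ ^ (1 - 1 / p)) atTop (𝓝 0) := by
      have h3 := h1.ennrpow_const (1 / p)
      rw [ENNReal.zero_rpow_of_pos (by positivity)] at h3
      have h4 := ENNReal.Tendsto.mul_const (b := (m.restrict B) univ ^ (1 - 1 / p)) h3
        (Or.inr (ENNReal.rpow_ne_top_of_nonneg (by
          rw [sub_nonneg, div_le_one hp0]; exact hp) (measure_ne_top _ _)))
      simpa using h4
    refine tendsto_of_tendsto_of_tendsto_of_le_of_le tendsto_const_nhds h2 (fun _ => zero_le) ?_
    intro n
    refine (lintegral_le_rpow (m.restrict B) p hp (fun y => w n y - u y)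
      ((hwc n).measurable.sub hu).aestronglyMeasurable).trans ?_
    refine mul_le_mul' (ENNReal.rpow_le_rpow ?_ (by positivity)) le_rfl
    calc _ = ∫⁻ y in B, ENNReal.ofReal |v n y - u y| ^ p ∂m := by
          refine setLIntegral_congr_fun isClosed_closedBall.measurableSet fun y hy => ?_
          simp only [hvw n (hBK hy)]
      _ ≤ _ := lintegral_mono_set hBK
  obtain ⟨Cu, hCu⟩ := hub
  have hui : IntegrableOn u B m := by
    refine Integrable.of_bound hu.aestronglyMeasurable Cu (Eventually.of_forall hCu)
  have hwi : ∀ n, IntegrableOn (w n) B m := fun n => (hwc n).continuousOn.integrableOn_compact' hBc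
    isClosed_closedBall.measurableSet
  have main : ∀ n, (m B)⁻¹ * ∫⁻ x' in B, ENNReal.ofReal |u x' - ⨍ x'' in B, u x'' ∂m| ∂m ≤
      2 * ((m B)⁻¹ * e n) + ENNReal.ofReal (CP * r) *
          ((m (closedBall x (lam * r)))⁻¹ *
              ∫⁻ x' in Ω', lipAt Ω' (v n) x' ^ p ∂m) ^ (1 / p) := by
    intro n
    have hc : ENNReal.ofReal |(⨍ x'' in B, w n x'' ∂m) - ⨍ x'' in B, u x'' ∂m| ≤
        (m B)⁻¹ * e n := by
      have : (⨍ x'' in B, w n x'' ∂m) - ⨍ x'' in B, u x'' ∂m =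
          ⨍ x'' in B, (w n x'' - u x'') ∂m := by
        simp only [setAverage_eq, smul_eq_mul]
        rw [integral_sub (hwi n) hui]; ring
      rw [this]
      exact ofReal_abs_average_le m B _
    have h1 : ∫⁻ x' in B, ENNReal.ofReal |u x' - ⨍ x'' in B, u x'' ∂m| ∂m ≤
        e n + (∫⁻ x' in B, ENNReal.ofReal |w n x' - ⨍ x'' in B, w n x'' ∂m| ∂m) +
          (m B)⁻¹ * e n * m B := by
      calc _ ≤ ∫⁻ x' in B, (ENNReal.ofReal |w n x' - u x'| +
            ENNReal.ofReal |w n x' - ⨍ x'' in B, w n x'' ∂m| + (m B)⁻¹ * e n) ∂m := by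
            refine lintegral_mono fun y => ?_
            refine le_trans ?_ (add_le_add le_rfl hc)
            rw [← ENNReal.ofReal_add (abs_nonneg _) (abs_nonneg _),
              ← ENNReal.ofReal_add (by positivity) (abs_nonneg _)]
            refine ENNReal.ofReal_le_ofReal ?_
            have e1 : u y - ⨍ x'' in B, u x'' ∂m = -(w n y - u y) +
              (w n y - ⨍ x'' in B, w n x'' ∂m) +
              ((⨍ x'' in B, w n x'' ∂m) - ⨍ x'' in B, u x'' ∂m) := by ring
            rw [e1]
            refine (abs_add_le _ _).trans (add_le_add ((abs_add_le _ _).trans ?_) le_rfl)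
            rw [abs_neg]
        _ = _ := by
            have hme : Measurable fun y => ENNReal.ofReal |w n y - u y| := by
              have := (hwc n).measurable
              fun_prop
            have hmw : Measurable fun y => ENNReal.ofReal |w n y - ⨍ x'' in B, w n x'' ∂m| := by
              have := (hwc n).measurable
              fun_prop
            rw [lintegral_add_right _ measurable_const, lintegral_add_left hme, lintegral_const]
            simp [e]
    have h2 : ∫⁻ x' in closedBall x (lam * r), lipAt univ (w n) x' ^ p ∂m ≤
        ∫⁻ x' in Ω', lipAt Ω' (v n) x' ^ p ∂m := by
      have hs1 : closedBall x (lam * r) ⊆ ball x (2 * (lam * r)) :=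
        closedBall_subset_ball (by nlinarith)
      have hs2 : ball x (2 * (lam * r)) ⊆ K := ball_subset_closedBall
      calc _ = ∫⁻ x' in closedBall x (lam * r), lipAt Ω' (v n) x' ^ p ∂m := by
            refine setLIntegral_congr_fun isClosed_closedBall.measurableSet fun y hy => ?_
            rw [lipAt_congr isOpen_ball (hs2.trans hsub) ((hvw n).mono hs2) (hs1 hy)]
        _ ≤ _ := lintegral_mono_set ((hs1.trans hs2).trans hsub)
    have h3 : (m B)⁻¹ * m B = 1 := ENNReal.inv_mul_cancel hm0.ne' hmt.ne
    calc _ ≤ (m B)⁻¹ * (e n + (∫⁻ x' in B, ENNReal.ofReal |w n x' - ⨍ x'' in B, w n x'' ∂m| ∂m) +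
          (m B)⁻¹ * e n * m B) := by gcongr
      _ = 2 * ((m B)⁻¹ * e n) +
          (m B)⁻¹ * (∫⁻ x' in B, ENNReal.ofReal |w n x' - ⨍ x'' in B, w n x'' ∂m| ∂m) := by
          rw [mul_add, mul_add, mul_comm ((m B)⁻¹ * e n) (m B), ← mul_assoc, h3, one_mul]
          ring
      _ ≤ _ := by
          refine add_le_add le_rfl ((hPI (w n) (hw n)).trans ?_)
          gcongr
  have hfreq := frequently_lt_of_liminf_lt (f := atTop) (by isBoundedDefault) hL
  have hle : ∃ᶠ n in atTop, (m B)⁻¹ * ∫⁻ x' in B, ENNReal.ofReal |u x' - ⨍ x'' in B, u x'' ∂m| ∂m ≤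
      2 * ((m B)⁻¹ * e n) + ENNReal.ofReal (CP * r) *
          ((m (closedBall x (lam * r)))⁻¹ * L) ^ (1 / p) := by
    refine hfreq.mono fun n hn => (main n).trans ?_
    gcongr
  have ht : Tendsto (fun n => 2 * ((m B)⁻¹ * e n) + ENNReal.ofReal (CP * r) *
          ((m (closedBall x (lam * r)))⁻¹ * L) ^ (1 / p)) atTop (𝓝 (2 * ((m B)⁻¹ * 0) +
          ENNReal.ofReal (CP * r) * ((m (closedBall x (lam * r)))⁻¹ * L) ^ (1 / p))) := by
    refine Tendsto.add ?_ tendsto_const_nhds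
    refine ENNReal.Tendsto.const_mul (ENNReal.Tendsto.const_mul he0 (Or.inr ?_)) (Or.inr (by simp))
    simpa using hm0.ne'
  have := ge_of_tendsto_of_frequently ht hle
  simpa using this

theorem avg_diff_le {X : Type*} [MeasurableSpace X] (m : Measure X) (A B : Set X) (hAB : A ⊆ B)
    (hA0 : 0 < m A) (hBt : m B < ⊤) (C : ℝ≥0) (hC : m B ≤ C * m A) (u : X → ℝ)
    (hu : IntegrableOn u B m) (t : ℝ) (ht : 0 ≤ t)
    (h : (m B)⁻¹ * ∫⁻ x' in B, ENNReal.ofReal |u x' - ⨍ x'' in B, u x'' ∂m| ∂m ≤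
      ENNReal.ofReal t) :
    |(⨍ x' in A, u x' ∂m) - ⨍ x' in B, u x' ∂m| ≤ C * t := by
  have hB0 : 0 < m B := hA0.trans_le (measure_mono hAB)
  have hAt : m A < ⊤ := (measure_mono hAB).trans_lt hBt
  set c := ⨍ x' in B, u x' ∂m with hc
  have h1 : (⨍ x' in A, u x' ∂m) - c = ⨍ x' in A, (u x' - c) ∂m := by
    have hfin : IsFiniteMeasure (m.restrict A) := ⟨by simpa using hAt⟩
    simp only [setAverage_eq, smul_eq_mul]
    rw [integral_sub (hu.mono_set hAB) (integrable_const c)]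
    simp only [integral_const, smul_eq_mul, measureReal_restrict_apply_univ]
    have : m.real A ≠ 0 := (ENNReal.toReal_pos hA0.ne' hAt.ne).ne'
    field_simp
  have h2 : ENNReal.ofReal |(⨍ x' in A, u x' ∂m) - c| ≤ ENNReal.ofReal (C * t) := by
    rw [h1]
    refine (ofReal_abs_average_le m A _).trans ?_
    set I := ∫⁻ x' in B, ENNReal.ofReal |u x' - c| ∂m with hI
    have h3 : I ≤ C * m A * ENNReal.ofReal t := by
      calc I = m B * ((m B)⁻¹ * I) := by
            rw [← mul_assoc, ENNReal.mul_inv_cancel hB0.ne' hBt.ne, one_mul]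
        _ ≤ _ := mul_le_mul' hC h
    calc _ ≤ (m A)⁻¹ * I := by gcongr; exact lintegral_mono_set hAB
      _ ≤ (m A)⁻¹ * (C * m A * ENNReal.ofReal t) := by gcongr
      _ = ((m A)⁻¹ * m A) * (C * ENNReal.ofReal t) := by ring
      _ = _ := by
        rw [ENNReal.inv_mul_cancel hA0.ne' hAt.ne, one_mul, ENNReal.ofReal_mul (by positivity)]
        simp
  exact (ENNReal.ofReal_le_ofReal_iff (by positivity)).1 h2

theorem two_point {X : Type*} [MetricSpace X] [MeasurableSpace X]
    (m : Measure X) (C : ℝ≥0) (D R : ℝ) (hD : 0 ≤ D) (hR : 0 < R) (u : X → ℝ) (G : Set X)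
    (hpos : ∀ z ∈ G, ∀ j : ℕ, 0 < m (closedBall z (R / 2 ^ j)))
    (hfin : ∀ z ∈ G, ∀ j : ℕ, m (closedBall z (R / 2 ^ j)) < ⊤)
    (hdoub : ∀ z ∈ G, ∀ j : ℕ, m (closedBall z (R / 2 ^ j)) ≤
      C * m (closedBall z (R / 2 ^ (j + 1))))
    (hosc : ∀ z ∈ G, ∀ j : ℕ, (m (closedBall z (R / 2 ^ j)))⁻¹ *
      ∫⁻ x' in closedBall z (R / 2 ^ j),
        ENNReal.ofReal |u x' - ⨍ x'' in closedBall z (R / 2 ^ j), u x'' ∂m| ∂m ≤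
      ENNReal.ofReal (D * (R / 2 ^ j)))
    (hlim : ∀ z ∈ G, Tendsto (fun j : ℕ => ⨍ x'' in closedBall z (R / 2 ^ j), u x'' ∂m) atTop
      (𝓝 (u z)))
    (hIntegr : ∀ z ∈ G, ∀ j : ℕ, IntegrableOn u (closedBall z (R / 2 ^ j)) m)
    (x y : X) (hx : x ∈ G) (hy : y ∈ G) (hxy : dist x y ≤ R / 4) :
    |u x - u y| ≤ (12 * C + 4 * C ^ 2) * D * dist x y := by
  rcases eq_or_lt_of_le (dist_nonneg (x := x) (y := y)) with h0 | hd
  · have := dist_eq_zero.1 h0.symm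
    subst this
    simp
  set d := dist x y with hdd
  have tel : ∀ z ∈ G, ∀ n : ℕ, |(⨍ x'' in closedBall z (R / 2 ^ n), u x'' ∂m) - u z| ≤
      2 * C * D * R / 2 ^ n := by
    intro z hz n
    rw [← Real.dist_eq]
    refine dist_le_of_le_geometric_two_of_tendsto (C := 2 * C * D * R) ?_ (hlim z hz) n
    intro n
    rw [dist_comm, Real.dist_eq]
    refine (avg_diff_le m _ _ (closedBall_subset_closedBall ?_) (hpos z hz (n + 1)) (hfin z hz n)
      C (hdoub z hz n) u (hIntegr z hz n) _ (by positivity) (hosc z hz n)).trans_eq ?_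
    · rw [pow_succ]
      gcongr
      nlinarith [show (0 : ℝ) < 2 ^ n by positivity]
    · field_simp
  obtain ⟨i, hi1, hi2⟩ := exists_nat_pow_near_of_lt_one (x := 4 * d / R) (y := (1 / 2 : ℝ))
    (by positivity) (by rw [div_le_one hR]; linarith) (by norm_num) (by norm_num)
  have e0 : (R / 2 ^ i : ℝ) = R * (1 / 2) ^ i := by simp [div_eq_mul_inv]
  have e1 : (R / 2 ^ (i + 1) : ℝ) = R * (1 / 2) ^ i / 2 := by rw [← e0, pow_succ]; field_simp
  have e2 : (R / 2 ^ (i + 2) : ℝ) = R * (1 / 2) ^ i / 4 := by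
    rw [← e0, pow_add]; field_simp; norm_num
  set q := R * (1 / 2 : ℝ) ^ i with hq
  have hqpos : 0 < q := by positivity
  have hdq : d ≤ q / 4 := by
    rw [div_le_iff₀ hR] at hi2
    linarith
  have hqd : q < 8 * d := by
    rw [lt_div_iff₀ hR, pow_succ] at hi1
    linarith
  have tx := tel x hx (i + 1)
  have ty := tel y hy (i + 2)
  have hsub1 : closedBall y (R / 2 ^ (i + 2)) ⊆ closedBall x (R / 2 ^ (i + 1)) := by
    refine closedBall_subset_closedBall' ?_
    rw [e1, e2, dist_comm]; linarith
  have hsub2 : closedBall x (R / 2 ^ (i + 1)) ⊆ closedBall y (R / 2 ^ i) := by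
    refine closedBall_subset_closedBall' ?_
    rw [e1, e0]; linarith
  have hm2 : m (closedBall x (R / 2 ^ (i + 1))) ≤
      ((C ^ 2 : ℝ≥0) : ℝ≥0∞) * m (closedBall y (R / 2 ^ (i + 2))) := by
    calc _ ≤ m (closedBall y (R / 2 ^ i)) := measure_mono hsub2
      _ ≤ C * m (closedBall y (R / 2 ^ (i + 1))) := hdoub y hy i
      _ ≤ C * (C * m (closedBall y (R / 2 ^ (i + 1 + 1)))) := by
        gcongr; exact hdoub y hy (i + 1)
      _ = _ := by push_cast; ring
  have txy := avg_diff_le m _ _ hsub1 (hpos y hy (i + 2)) (hfin x hx (i + 1)) (C ^ 2) hm2 u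
    (hIntegr x hx (i + 1)) _ (by positivity) (hosc x hx (i + 1))
  rw [mul_div_assoc] at tx ty
  rw [e1] at tx txy
  rw [e2] at ty txy
  push_cast at txy
  set a := ⨍ x'' in closedBall x (q / 2), u x'' ∂m
  set b := ⨍ x'' in closedBall y (q / 4), u x'' ∂m
  have hfinal : |u x - u y| ≤ |a - u x| + |b - a| + |b - u y| := by
    have : u x - u y = -(a - u x) + -(b - a) + (b - u y) := by ring
    rw [this]
    refine (abs_add_le _ _).trans (add_le_add ((abs_add_le _ _).trans ?_) le_rfl)
    rw [abs_neg, abs_neg]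
  refine hfinal.trans ?_
  have hCn : (0 : ℝ) ≤ C := C.2
  calc _ ≤ 2 * C * D * (q / 2) + C ^ 2 * (D * (q / 2)) + 2 * C * D * (q / 4) :=
        add_le_add (add_le_add tx txy) ty
    _ = (3 / 2 * C + C ^ 2 / 2) * D * q := by ring
    _ ≤ (3 / 2 * C + C ^ 2 / 2) * D * (8 * d) := by gcongr
    _ = _ := by ring

theorem osc_bound {X : Type*} [MetricSpace X] [MeasurableSpace X] [BorelSpace X]
    [SecondCountableTopology X]
    (m : Measure X) [IsLocallyFiniteMeasure m] (p : ℝ) (hp : 1 ≤ p) (CP lam : ℝ) (hCP : 0 ≤ CP)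
    (hlam : 1 ≤ lam) (x : X) (r : ℝ) (hr : 0 < r)
    (hPI : ∀ u : X → ℝ, (∃ K : NNReal, LipschitzWith K u) →
      (m (closedBall x r))⁻¹ *
          ∫⁻ x' in closedBall x r,
            ENNReal.ofReal |u x' - ⨍ x'' in closedBall x r, u x'' ∂m| ∂m ≤
        ENNReal.ofReal (CP * r) *
          ((m (closedBall x (lam * r)))⁻¹ *
              ∫⁻ x' in closedBall x (lam * r), lipAt univ u x' ^ p ∂m) ^ (1 / p))
    (hK : IsCompact (closedBall x (2 * (lam * r)))) (hm0 : 0 < m (closedBall x r))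
    (C_D : ℝ≥0)
    (hdoub : m (closedBall x (2 * (lam * r))) ≤ C_D * m (closedBall x (lam * r)))
    (Ω : Set X) (u u' : X → ℝ) (huu' : EqOn u u' Ω)
    (hu' : Measurable u') (hub : ∃ C, ∀ x, |u' x| ≤ C) (k : ℕ)
    (hc : cheegerSet m p Ω u (closedBall x (2 * (lam * r))) ≤
      k * m (closedBall x (2 * (lam * r)))) :
    (m (closedBall x r))⁻¹ *
          ∫⁻ x' in closedBall x r,
            ENNReal.ofReal |u' x' - ⨍ x'' in closedBall x r, u' x'' ∂m| ∂m ≤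
        ENNReal.ofReal (CP * ((k + 1) * C_D) ^ (1 / p) * r) := by
  have hlr : r ≤ lam * r := by nlinarith
  have hp0 : 0 < p := by linarith
  have hmKt : m (closedBall x (2 * (lam * r))) < ⊤ := hK.measure_lt_top
  have hsub1 : closedBall x r ⊆ closedBall x (lam * r) := closedBall_subset_closedBall hlr
  have hsub2 : closedBall x (lam * r) ⊆ closedBall x (2 * (lam * r)) :=
    closedBall_subset_closedBall (by linarith)
  have hm1 : 0 < m (closedBall x (lam * r)) := hm0.trans_le (measure_mono hsub1)
  have hm1t : m (closedBall x (lam * r)) < ⊤ := (measure_mono hsub2).trans_lt hmKt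
  have hm2 : 0 < m (closedBall x (2 * (lam * r))) := hm1.trans_le (measure_mono hsub2)
  have hlt : cheegerSet m p Ω u (closedBall x (2 * (lam * r))) <
      (k + 1) * m (closedBall x (2 * (lam * r))) := by
    refine hc.trans_lt ?_
    rw [add_mul, one_mul]
    exact ENNReal.lt_add_right (ENNReal.mul_ne_top (by simp) hmKt.ne) hm2.ne'
  unfold cheegerSet cheegerOpen at hlt
  simp only [iInf_lt_iff] at hlt
  obtain ⟨Ω', hΩ', hΩ'Ω, hKΩ', v, hv, htend, hL⟩ := hlt
  have htend' : TendstoLpLoc m p Ω' v u' := by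
    intro z hz
    obtain ⟨s, hs, hT⟩ := htend z hz
    refine ⟨s, hs, hT.congr fun n => ?_⟩
    refine setLIntegral_congr_fun (hΩ'.measurableSet.inter isClosed_closedBall.measurableSet)
      fun y hy => ?_
    simp only [huu' (hΩ'Ω hy.1)]
  refine (poincare_relaxed m p hp CP lam hlam x r hr hPI hK hm0
    ((measure_mono (hsub1.trans hsub2)).trans_lt hmKt) Ω' hΩ' hKΩ' v hv u' hu' hub htend' _
    hL).trans ?_
  have h1 : (m (closedBall x (lam * r)))⁻¹ * ((k + 1) * m (closedBall x (2 * (lam * r)))) ≤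
      ENNReal.ofReal ((k + 1) * C_D) := by
    calc _ ≤ (m (closedBall x (lam * r)))⁻¹ * ((k + 1) * (C_D * m (closedBall x (lam * r)))) := by
          gcongr
      _ = ((m (closedBall x (lam * r)))⁻¹ * m (closedBall x (lam * r))) * ((k + 1) * C_D) := by
          ring
      _ = _ := by
          rw [ENNReal.inv_mul_cancel hm1.ne' hm1t.ne, one_mul, ENNReal.ofReal_mul (by positivity),
            ENNReal.ofReal_add (by positivity) (by norm_num)]
          simp
  calc _ ≤ ENNReal.ofReal (CP * r) * (ENNReal.ofReal ((k + 1) * C_D)) ^ (1 / p) := by gcongr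
    _ = _ := by
      rw [ENNReal.ofReal_rpow_of_nonneg (by positivity) (by positivity),
        ← ENNReal.ofReal_mul (by positivity)]
      congr 1; ring

theorem exists_vitali {X : Type*} [MetricSpace X] [MeasurableSpace X] [BorelSpace X]
    [SecondCountableTopology X] (m : Measure X) [IsLocallyFiniteMeasure m] (C : ℝ≥0)
    (h : ∀ x : X, ∃ R > 0, ∀ r, 0 < r → r ≤ R →
      m (closedBall x (3 * r)) ≤ C * m (closedBall x r)) :
    ∃ vf : VitaliFamily m, ∀ (x : X) (R : ℝ), 0 < R →
      Tendsto (fun j : ℕ => closedBall x (R / 2 ^ j)) atTop (vf.filterAt x) := by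
  have hfreq : ∀ x : X, ∃ᶠ r in 𝓝[>] (0:ℝ), m (closedBall x (3 * r)) ≤ C * m (closedBall x r) := by
    intro x
    obtain ⟨R, hR, hx⟩ := h x
    refine Eventually.frequently ?_
    filter_upwards [Ioc_mem_nhdsGT hR] with r hr
    exact hx r hr.1 hr.2
  refine ⟨Vitali.vitaliFamily m C hfreq, fun x R hR => ?_⟩
  have ht : Tendsto (fun j : ℕ => R / 2 ^ j) atTop (𝓝 0) := by
    have : Tendsto (fun n : ℕ => R * (1 / 2 : ℝ) ^ n) atTop (𝓝 (R * 0)) :=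
      (tendsto_pow_atTop_nhds_zero_of_lt_one (by norm_num) (by norm_num)).const_mul R
    simpa [div_eq_mul_inv] using this
  rw [VitaliFamily.tendsto_filterAt_iff]
  constructor
  · obtain ⟨R0, hR0, hx⟩ := h x
    filter_upwards [ht.eventually (gt_mem_nhds hR0)] with j hj
    have hpos : 0 < R / 2 ^ j := by positivity
    refine ⟨isClosed_closedBall, ⟨x, ?_⟩, R / 2 ^ j, subset_rfl, hx _ hpos hj.le⟩
    exact ball_subset_interior_closedBall (mem_ball_self hpos)
  · intro ε hε
    filter_upwards [ht.eventually (gt_mem_nhds hε)] with j hj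
    exact closedBall_subset_closedBall hj.le

theorem bddLip1_min {Y : Type*} [MetricSpace Y] (c : Y) (N : ℕ) :
    BddLip1 (fun y : Y => min (dist y c) (N : ℝ)) := by
  refine ⟨⟨N, fun y => ?_⟩, ?_⟩
  · rw [abs_of_nonneg (le_min dist_nonneg (by positivity))]
    exact min_le_right _ _
  · exact (LipschitzWith.dist_left c).min_const _

theorem dist_le_of_family {Y : Type*} [MetricSpace Y] (S : Set Y) (y z : Y) (hy : y ∈ closure S)
    (t : ℝ) (h : ∀ c ∈ S, ∀ N : ℕ, |min (dist y c) (N : ℝ) - min (dist z c) (N : ℝ)| ≤ t) :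
    dist y z ≤ t := by
  refine le_of_forall_pos_le_add fun ε hε => ?_
  obtain ⟨c, hc, hyc⟩ := Metric.mem_closure_iff.1 hy (ε / 2) (by positivity)
  obtain ⟨N, hN⟩ := exists_nat_ge (max (dist y c) (dist z c))
  have h1 := h c hc N
  rw [min_eq_left ((le_max_left _ _).trans hN), min_eq_left ((le_max_right _ _).trans hN)] at h1
  have h2 := (abs_le.1 h1).1
  have h3 := dist_triangle_right y z c
  linarith

theorem ratio_bdd (a b : ℕ → ℝ≥0∞) (ha : ∀ j, a j ≠ ⊤) (hb : ∀ j, b j ≠ 0)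
    (hbt : ∀ j, b j ≠ ⊤)
    (L : ℝ≥0∞) (hL : L ≠ ⊤) (h : Tendsto (fun j => a j / b j) atTop (𝓝 L)) :
    ∃ k : ℕ, ∀ j, a j ≤ k * b j := by
  have h1 := ((ENNReal.tendsto_toReal hL).comp h).bddAbove_range
  obtain ⟨M, hM⟩ := h1
  obtain ⟨k, hk⟩ := exists_nat_ge M
  refine ⟨k, fun j => ?_⟩
  have h2 : (a j / b j).toReal ≤ k := (hM ⟨j, rfl⟩).trans hk
  have h3 : a j / b j ≤ k := by
    rw [← ENNReal.ofReal_toReal (ENNReal.div_ne_top (ha j) (hb j)), ← ENNReal.ofReal_natCast]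
    exact ENNReal.ofReal_le_ofReal h2
  exact (ENNReal.div_le_iff (hb j) (hbt j)).1 h3

theorem local_luzin
    {X : Type*} [MetricSpace X] [SecondCountableTopology X] [MeasurableSpace X] [BorelSpace X]
    (hloc : ∀ x : X, ∃ r > 0, IsComplete (closedBall x r))
    (m : Measure X) [IsLocallyFiniteMeasure m]
    (p : ℝ) (hp : 1 ≤ p)
    (C_D : ℝ≥0) (hD : InternallyDoubling m C_D)
    (C_P lam : ℝ) (hP : InternalPoincare m p C_P lam)
    (Ω : Set X) (hΩ : IsOpen Ω)
    (Y : Type*) [MetricSpace Y] (f : X → Y) (hf : MemB m Ω f)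
    (ν : OuterMeasure X) (hν : IsCheegerEnergy m p Ω f ν) (hfin : ν Ω < ⊤)
    (E : Set X) (hE : MeasurableSet E) (hEΩ : E ⊆ Ω) (x0 : X) (hx0 : x0 ∈ Ω) :
    ∃ ρ > 0, LuzinLipschitzOn m (E ∩ ball x0 ρ) f := by
  obtain ⟨-, hD⟩ := hD
  obtain ⟨hCP, hlam, hP⟩ := hP
  obtain ⟨RD, hRD, hDx⟩ := hD {x0} (wellInside_singleton hloc x0)
  obtain ⟨RP, hRP, hPx⟩ := hP {x0} (wellInside_singleton hloc x0)
  obtain ⟨δ1, hδ1, hcompl⟩ := hloc x0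
  obtain ⟨δ2, hδ2, hδΩ⟩ := Metric.nhds_basis_closedBall.mem_iff.1 (hΩ.mem_nhds hx0)
  obtain ⟨δ, hδ, hδa, hδb, hδc, hδd⟩ : ∃ δ > 0, δ ≤ RD / 8 ∧ δ ≤ RP ∧ δ ≤ δ1 ∧ δ ≤ δ2 :=
    ⟨min (min (RD / 8) RP) (min δ1 δ2), by positivity,
      (min_le_left _ _).trans (min_le_left _ _), (min_le_left _ _).trans (min_le_right _ _),
      (min_le_right _ _).trans (min_le_left _ _), (min_le_right _ _).trans (min_le_right _ _)⟩
  have hcpt : IsCompact (closedBall x0 δ) := by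
    have h1 : TotallyBounded (closedBall x0 δ) :=
      (totallyBounded_of_doubling m C_D x0 RD hRD hDx).subset (closedBall_subset_closedBall hδa)
    have h2 : IsComplete (closedBall x0 δ) := by
      intro F hF hFs
      obtain ⟨y, -, hFy⟩ := hcompl F hF
        (hFs.trans (Filter.principal_mono.2 (closedBall_subset_closedBall hδc)))
      haveI := hF.1
      exact ⟨y, isClosed_closedBall.mem_of_frequently_of_tendsto
        (Filter.Eventually.frequently (Filter.le_principal_iff.1 hFs)) (f := id) hFy, hFy⟩
    exact isCompact_iff_totallyBounded_isComplete.2 ⟨h1, h2⟩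
  set R := δ / (4 * lam) with hRdef
  have hlam0 : 0 < lam := by linarith
  have hR : 0 < R := by positivity
  have hlamR : lam * R = δ / 4 := by rw [hRdef]; field_simp
  have hRδ : R ≤ δ / 4 := by rw [← hlamR]; nlinarith
  have hRj : ∀ j : ℕ, R / 2 ^ j ≤ R := fun j => div_le_self hR.le (one_le_pow₀ (by norm_num))
  have hRjpos : ∀ j : ℕ, 0 < R / 2 ^ j := fun j => by positivity
  have hlamRj : ∀ j : ℕ, lam * (R / 2 ^ j) ≤ δ / 4 := fun j => by
    rw [← hlamR]; gcongr; exact hRj j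
  refine ⟨R / 8, by positivity, ?_⟩
  -- facts for points of the small ball
  have hsubK : ∀ z ∈ ball x0 (R / 8), ∀ j : ℕ,
      closedBall z (2 * (lam * (R / 2 ^ j))) ⊆ closedBall x0 δ := by
    intro z hz j
    refine closedBall_subset_closedBall' ?_
    rw [mem_ball] at hz
    have := hlamRj j
    linarith
  have hsB : ∀ z ∈ ball x0 (R / 8), z ∈ setBall {x0} RD ∧ z ∈ setBall {x0} RP := by
    intro z hz
    rw [mem_ball] at hz
    exact ⟨mem_setBall_singleton (by linarith), mem_setBall_singleton (by linarith)⟩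
  have hpos : ∀ z ∈ ball x0 (R / 8), ∀ j : ℕ, 0 < m (closedBall z (R / 2 ^ j)) := by
    intro z hz j
    have h1 := (hDx z (hsB z hz).1 (R / 2 ^ j / 2) (by positivity)
      (by have := hRj j; have := hRjpos j; linarith)).1
    rwa [mul_div_cancel₀ _ (by norm_num)] at h1
  have hfinm : ∀ z ∈ ball x0 (R / 8), ∀ j : ℕ, m (closedBall z (R / 2 ^ j)) < ⊤ := by
    intro z hz j
    exact (hDx z (hsB z hz).1 (R / 2 ^ j) (by positivity)
      (by have := hRj j; have := hRjpos j; linarith)).2.2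
  have hdoub : ∀ z ∈ ball x0 (R / 8), ∀ j : ℕ, m (closedBall z (R / 2 ^ j)) ≤
      C_D * m (closedBall z (R / 2 ^ (j + 1))) := by
    intro z hz j
    have h1 := (hDx z (hsB z hz).1 (R / 2 ^ (j + 1)) (by positivity)
      (by have := hRj (j + 1); linarith)).2.1
    have h2 : 2 * (R / 2 ^ (j + 1)) = R / 2 ^ j := by rw [pow_succ]; field_simp
    rwa [h2] at h1
  have hdoubK : ∀ z ∈ ball x0 (R / 8), ∀ j : ℕ, m (closedBall z (2 * (lam * (R / 2 ^ j)))) ≤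
      C_D * m (closedBall z (lam * (R / 2 ^ j))) := by
    intro z hz j
    exact (hDx z (hsB z hz).1 (lam * (R / 2 ^ j)) (by positivity)
      (by have := hlamRj j; linarith)).2.1
  have hposK : ∀ z ∈ ball x0 (R / 8), ∀ j : ℕ, 0 < m (closedBall z (2 * (lam * (R / 2 ^ j)))) := by
    intro z hz j
    exact (hDx z (hsB z hz).1 (lam * (R / 2 ^ j)) (by positivity)
      (by have := hlamRj j; linarith)).1
  have hcptK : ∀ z ∈ ball x0 (R / 8), ∀ j : ℕ,
      IsCompact (closedBall z (2 * (lam * (R / 2 ^ j)))) := fun z hz j =>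
    hcpt.of_isClosed_subset isClosed_closedBall (hsubK z hz j)
  have hKΩ : ∀ z ∈ ball x0 (R / 8), ∀ j : ℕ,
      closedBall z (2 * (lam * (R / 2 ^ j))) ⊆ Ω := fun z hz j =>
    (hsubK z hz j).trans ((closedBall_subset_closedBall hδd).trans hδΩ)
  -- the Vitali family
  obtain ⟨vf, hvf⟩ := exists_vitali m (C_D ^ 2) (by
    intro x
    obtain ⟨R', hR', hx⟩ := hD {x} (wellInside_singleton hloc x)
    refine ⟨R' / 2, by positivity, fun r hr hrR => ?_⟩
    have hxm : x ∈ setBall {x} R' := mem_setBall_singleton (by simpa using hR'.le)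
    have h1 := (hx x hxm r hr (by linarith)).2.1
    have h2 := (hx x hxm (2 * r) (by linarith) (by linarith)).2.1
    calc m (closedBall x (3 * r)) ≤ m (closedBall x (2 * (2 * r))) :=
          measure_mono (closedBall_subset_closedBall (by linarith))
      _ ≤ C_D * (C_D * m (closedBall x r)) := h2.trans (by gcongr)
      _ = _ := by push_cast; ring)
  -- the energy measure
  obtain ⟨⟨hcar, -⟩, hdom, -⟩ := hν
  have hcar' : ‹MeasurableSpace X› ≤ ν.caratheodory := fun B hB => hcar B hB
  set ν1 : Measure X := ν.toMeasure hcar' with hν1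
  set ν' : Measure X := ν1.restrict Ω with hν'
  have hν'fin : IsFiniteMeasure ν' := ⟨by
    rw [hν', Measure.restrict_apply_univ, hν1, toMeasure_apply _ _ hΩ.measurableSet]
    exact hfin⟩
  have hν'eq : ∀ S : Set X, MeasurableSet S → S ⊆ Ω → ν' S = ν S := by
    intro S hS hSΩ
    rw [hν', Measure.restrict_apply hS, inter_eq_left.2 hSΩ, hν1, toMeasure_apply _ _ hS]
  -- the countable family of functions
  obtain ⟨hfm, N, -, hN0, hsep⟩ := hf
  obtain ⟨S, hScount, hSd⟩ := hsep
  let U : Y → ℕ → X → ℝ := fun c n => Ω.indicator fun x => min (dist (f x) c) (n : ℝ)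
  have hUm : ∀ c n, Measurable (U c n) := by
    intro c n
    letI : MeasurableSpace Y := borel Y
    haveI : BorelSpace Y := ⟨rfl⟩
    have h1 : Measurable (fun y : Y => min (dist y c) (n : ℝ)) :=
      ((continuous_id.dist continuous_const).min continuous_const).measurable
    have h2 : Measurable (fun x : Ω => min (dist (f x) c) (n : ℝ)) := h1.comp hfm
    refine measurable_of_restrict_of_restrict_compl hΩ.measurableSet ?_ ?_
    · convert h2 using 1
      ext x
      simp [U, Set.domRestrict]
    · have : Ωᶜ.domRestrict (U c n) = fun _ => 0 := by
        ext x
        simp only [Set.domRestrict_apply, U]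
        exact indicator_of_notMem x.2 _
      rw [this]
      exact measurable_const
  have hUb : ∀ c n x, |U c n x| ≤ n := by
    intro c n x
    by_cases hx : x ∈ Ω
    · simp only [U, indicator_of_mem hx]
      rw [abs_of_nonneg (le_min dist_nonneg (by positivity))]
      exact min_le_right _ _
    · simp only [U, indicator_of_notMem hx, abs_zero]
      positivity
  have hUli : ∀ c n, LocallyIntegrable (U c n) m := by
    intro c n x
    obtain ⟨s, hs, hsm⟩ := m.finiteAt_nhds x
    refine ⟨s, hs, ?_⟩
    haveI : IsFiniteMeasure (m.restrict s) := ⟨by simpa using hsm⟩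
    exact Integrable.of_bound (hUm c n).aestronglyMeasurable n (Eventually.of_forall (hUb c n))
  have hae1 : ∀ᵐ x ∂m, ∀ c ∈ S, ∀ n : ℕ,
      Tendsto (fun a => ⨍ y in a, U c n y ∂m) (vf.filterAt x) (𝓝 (U c n x)) := by
    rw [ae_ball_iff hScount]
    intro c _
    rw [ae_all_iff]
    intro n
    exact vf.ae_tendsto_average (hUli c n)
  have hae2 : ∀ᵐ x ∂m, ∃ L : ℝ≥0∞, L ≠ ⊤ ∧ Tendsto (fun a => ν' a / m a) (vf.filterAt x) (𝓝 L) := by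
    filter_upwards [vf.ae_tendsto_rnDeriv ν', Measure.rnDeriv_lt_top ν' m] with x h1 h2
    exact ⟨_, h2.ne, h1⟩
  have hae3 : ∀ᵐ x ∂m, x ∉ N := measure_eq_zero_iff_ae_notMem.1 hN0
  have hae := hae1.and (hae2.and hae3)
  obtain ⟨Z, hZsub, hZm, hZ0⟩ := exists_measurable_superset_of_null (ae_iff.1 hae)
  have hgood : ∀ x, x ∉ Z → _ := fun x hx => not_not.1 fun h => hx (hZsub h)
  let G : ℕ → Set X := fun k => {z | ∀ j : ℕ, ν' (closedBall z (2 * (lam * (R / 2 ^ j)))) ≤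
    k * m (closedBall z (2 * (lam * (R / 2 ^ j))))}
  have hmeasball : ∀ (μ : Measure X) [SFinite μ] (r : ℝ),
      Measurable fun z => μ (closedBall z r) := by
    intro μ _ r
    have hs : MeasurableSet {q : X × X | dist q.2 q.1 ≤ r} :=
      (isClosed_le (continuous_snd.dist continuous_fst) continuous_const).measurableSet
    exact measurable_measure_prodMk_left hs
  have hGm : ∀ k, MeasurableSet (G k) := by
    intro k
    have : G k = ⋂ j : ℕ, {z | ν' (closedBall z (2 * (lam * (R / 2 ^ j)))) ≤
      k * m (closedBall z (2 * (lam * (R / 2 ^ j))))} := by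
      ext z; simp [G]
    rw [this]
    exact MeasurableSet.iInter fun j => measurableSet_le (hmeasball ν' _)
      ((hmeasball m _).const_mul _)
  refine ⟨fun k => ((E ∩ ball x0 (R / 8)) ∩ G k) \ Z, fun k => ⟨?_, ?_⟩, ?_, fun k => ?_⟩
  · exact ((hE.inter measurableSet_ball).inter (hGm k)).diff hZm
  · exact fun z hz => hz.1.1
  · refine measure_mono_null ?_ hZ0
    rintro z ⟨hz, hzn⟩
    by_contra hzZ
    apply hzn
    obtain ⟨-, ⟨L, hL, hT⟩, -⟩ := hgood z hzZ
    have hT2 := hT.comp (hvf z (2 * (lam * R)) (by positivity))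
    have hrad : ∀ j : ℕ, 2 * (lam * R) / 2 ^ j = 2 * (lam * (R / 2 ^ j)) := fun j => by ring
    obtain ⟨k, hk⟩ := ratio_bdd (fun j => ν' (closedBall z (2 * (lam * (R / 2 ^ j)))))
      (fun j => m (closedBall z (2 * (lam * (R / 2 ^ j))))) (fun j => measure_ne_top _ _)
      (fun j => (hposK z hz.2 j).ne') (fun j => (hcptK z hz.2 j).measure_lt_top.ne) L hL
      (hT2.congr fun j => by simp only [Function.comp, hrad])
    exact mem_iUnion.2 ⟨k, ⟨hz, hk⟩, hzZ⟩
  · set D : ℝ := C_P * ((k + 1) * C_D) ^ (1 / p) with hDdef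
    have hD0 : 0 ≤ D := by positivity
    have hK0 : (0 : ℝ) ≤ (12 * C_D + 4 * C_D ^ 2) * D := by positivity
    refine ⟨⟨(12 * C_D + 4 * C_D ^ 2) * D, hK0⟩, LipschitzOnWith.of_dist_le_mul ?_⟩
    intro x hx y hy
    change dist (f x) (f y) ≤ (12 * C_D + 4 * C_D ^ 2) * D * dist x y
    have hxΩ : x ∈ Ω := hEΩ hx.1.1.1
    have hyΩ : y ∈ Ω := hEΩ hy.1.1.1
    refine dist_le_of_family S (f x) (f y)
      (hSd ⟨x, ⟨hxΩ, (hgood x hx.2).2.2⟩, rfl⟩) _ fun c hc n => ?_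
    have h2 := two_point m C_D D R hD0 hR (U c n)
      (((E ∩ ball x0 (R / 8)) ∩ G k) \ Z)
      (fun z hz => hpos z hz.1.1.2) (fun z hz => hfinm z hz.1.1.2) (fun z hz => hdoub z hz.1.1.2)
      (fun z hz j => ?_)
      (fun z hz => ((hgood z hz.2).1 c hc n).comp (hvf z R hR))
      (fun z hz j => ?_) x y hx hy ?_
    · simpa only [U, indicator_of_mem hxΩ, indicator_of_mem hyΩ] using h2
    · have hzb := hz.1.1.2
      refine osc_bound m p hp C_P lam hCP.le hlam z (R / 2 ^ j) (hRjpos j)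
        (fun u hu => hPx.2 u hu z (hsB z hzb).2 (R / 2 ^ j) (hRjpos j)
          (by have := hRj j; linarith)) (hcptK z hzb j) (hpos z hzb j) C_D (hdoubK z hzb j)
        Ω ((fun y : Y => min (dist y c) (n : ℝ)) ∘ f) (U c n)
        (fun w hw => ?_) (hUm c n) ⟨n, hUb c n⟩ k ?_
      · simp only [U, indicator_of_mem hw, Function.comp]
      · refine (hdom _ (hKΩ z hzb j) _ (bddLip1_min c n)).trans ?_
        rw [← hν'eq _ isClosed_closedBall.measurableSet (hKΩ z hzb j)]
        exact hz.1.2 j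
    · haveI : IsFiniteMeasure (m.restrict (closedBall z (R / 2 ^ j))) :=
        ⟨by simpa using hfinm z hz.1.1.2 j⟩
      exact Integrable.of_bound (hUm c n).aestronglyMeasurable n (Eventually.of_forall (hUb c n))
    · have h3 := dist_triangle_right x y x0
      have h4 := hx.1.1.2
      have h5 := hy.1.1.2
      rw [mem_ball] at h4 h5
      linarith

theorem luzin_glue {X : Type*} [MetricSpace X] [SecondCountableTopology X] [MeasurableSpace X]
    (m : Measure X) (E : Set X) {Y : Type*} [MetricSpace Y] (f : X → Y)
    (h : ∀ x ∈ E, ∃ ρ > 0, LuzinLipschitzOn m (E ∩ ball x ρ) f) : LuzinLipschitzOn m E f := by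
  choose! ρ hρ hL using h
  obtain ⟨T, hTE, hTc, hcov⟩ := TopologicalSpace.countable_cover_nhdsWithin
    (f := fun x => ball x (ρ x)) (s := E)
    (fun x hx => mem_nhdsWithin_of_mem_nhds (ball_mem_nhds x (hρ x hx)))
  rcases T.eq_empty_or_nonempty with hT | hT
  · subst hT
    have hE : E = ∅ := by simpa using hcov
    subst hE
    exact ⟨fun _ => ∅, by simp, by simp, fun _ => ⟨0, by simp⟩⟩
  obtain ⟨g, hg⟩ := hTc.exists_eq_range hT
  have hgE : ∀ i, g i ∈ E := fun i => hTE (hg ▸ mem_range_self i)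
  choose E' h1 h2 h3 using fun i => hL (g i) (hgE i)
  refine ⟨fun n => E' n.unpair.1 n.unpair.2, fun n => ⟨(h1 _ _).1, (h1 _ _).2.trans inter_subset_left⟩,
    ?_, fun n => h3 _ _⟩
  refine measure_mono_null (t := ⋃ i, ((E ∩ ball (g i) (ρ (g i))) \ ⋃ k, E' i k)) ?_
    (measure_iUnion_null h2)
  rintro z ⟨hzE, hz⟩
  obtain ⟨t, ht, hzt⟩ := mem_iUnion₂.1 (hcov hzE)
  rw [hg] at ht
  obtain ⟨i, rfl⟩ := ht
  refine mem_iUnion.2 ⟨i, ⟨hzE, hzt⟩, fun hzk => hz ?_⟩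
  obtain ⟨k, hk⟩ := mem_iUnion.1 hzk
  refine mem_iUnion.2 ⟨Nat.pair i k, ?_⟩
  simpa using hk

theorem statement8
    {X : Type*} [MetricSpace X] [TopologicalSpace.SeparableSpace X] [ConnectedSpace X]
    [Nontrivial X] [MeasurableSpace X] [BorelSpace X]
    (hloc : ∀ x : X, ∃ r > 0, IsComplete (closedBall x r))
    (m : Measure X) [IsLocallyFiniteMeasure m] (hm : m ≠ 0)
    (p : ℝ) (hp : 1 ≤ p)
    (C_D : ℝ≥0) (hD : InternallyDoubling m C_D)
    (C_P lam : ℝ) (hP : InternalPoincare m p C_P lam)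
    (Ω : Set X) (hΩ : IsOpen Ω)
    (Y : Type*) [MetricSpace Y] (f : X → Y) (hf : MemB m Ω f)
    (ν : OuterMeasure X) (hν : IsCheegerEnergy m p Ω f ν) (hfin : ν Ω < ⊤) :
    ∀ E : Set X, MeasurableSet E → WellInside E Ω → LuzinLipschitzOn m E f := by
  intro E hE hEΩ
  haveI : SecondCountableTopology X := UniformSpace.secondCountable_of_separable X
  exact luzin_glue m E f fun x hx => local_luzin hloc m p hp C_D hD C_P lam hP Ω hΩ Y f hf ν hν hfin E hE hEΩ.1 x (hEΩ.1 hx)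

end BBM
end
end

section
/- Let p ∈ [1,∞) and let (ρ_δ)_{δ∈(0,1)} be a p-admissible family. Let Ω ⊆ X be open, (Y,d_Y) a metric space, and f ∈ L^p(Ω,Y). Then: limsup_{r↘0} limsup_{δ↘0} ∫_Ω ∫_{Ω\B(x,r)} d_f(x,x')^p·ρ_δ(x,x') dm(x') dm(x) = 0, and for every x ∈ Ω: limsup_{r↘0} limsup_{δ↘0} ∫_{Ω\B(x,r)} d_f(x,x')^p·ρ_δ(x,x') dm(x') = 0. -/
open MeasureTheory Filter Metric Set Topology
open scoped ENNReal NNReal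

noncomputable section

namespace BBM

variable {X : Type*} [MetricSpace X]

variable [MeasurableSpace X]

lemma limsup2_zero (F I S : ℝ → ℝ → ℝ≥0∞) (a b : ℝ≥0∞) (ha : a ≠ ⊤) (hb : b ≠ ⊤)
    (h : ∀ r, ∀ᶠ δ in 𝓝[>] (0:ℝ), F r δ ≤ a * I r δ + b * S r δ)
    (hI : limsup (fun r => limsup (fun δ => I r δ) (𝓝[>] (0:ℝ))) (𝓝[>] (0:ℝ)) = 0)
    (hS : limsup (fun r => limsup (fun δ => S r δ) (𝓝[>] (0:ℝ))) (𝓝[>] (0:ℝ)) = 0) :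
    limsup (fun r => limsup (fun δ => F r δ) (𝓝[>] (0:ℝ))) (𝓝[>] (0:ℝ)) = 0 := by
  have ha' : 2 * a ≠ ⊤ := ENNReal.mul_ne_top (by simp) ha
  have hb' : 2 * b ≠ ⊤ := ENNReal.mul_ne_top (by simp) hb
  have h1 : ∀ r, limsup (fun δ => F r δ) (𝓝[>] (0:ℝ)) ≤
      max (2 * a * limsup (fun δ => I r δ) (𝓝[>] (0:ℝ)))
        (2 * b * limsup (fun δ => S r δ) (𝓝[>] (0:ℝ))) := by
    intro r
    rw [← ENNReal.limsup_const_mul_of_ne_top ha', ← ENNReal.limsup_const_mul_of_ne_top hb',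
      ← limsup_max]
    refine limsup_le_limsup ((h r).mono fun δ hδ => hδ.trans ?_)
    beta_reduce
    rw [mul_assoc, mul_assoc]
    rcases le_total (a * I r δ) (b * S r δ) with h' | h'
    · refine le_max_of_le_right ?_
      rw [two_mul]; gcongr
    · refine le_max_of_le_left ?_
      rw [two_mul]; gcongr
  refine le_antisymm ?_ zero_le
  refine (limsup_le_limsup (Eventually.of_forall h1)).trans ?_
  rw [limsup_max, ENNReal.limsup_const_mul_of_ne_top ha', ENNReal.limsup_const_mul_of_ne_top hb',
    hI, hS]
  simp

theorem statement10
    {X : Type*} [MetricSpace X] [TopologicalSpace.SeparableSpace X] [ConnectedSpace X]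
    [Nontrivial X] [MeasurableSpace X] [BorelSpace X]
    (hloc : ∀ x : X, ∃ r > 0, IsComplete (closedBall x r))
    (m : Measure X) [IsLocallyFiniteMeasure m] (hm : m ≠ 0)
    (p : ℝ) (hp : 1 ≤ p)
    (ρ : ℝ → X → X → ℝ≥0) (C_M : ℝ≥0) (hρ : PAdmissible m p ρ C_M)
    (Ω : Set X) (hΩ : IsOpen Ω)
    (Y : Type*) [MetricSpace Y] (f : X → Y) (hf : MemLpY m p Ω f) :
    Filter.limsup (fun r : ℝ => Filter.limsup (fun δ : ℝ =>
        ∫⁻ x in Ω, ∫⁻ x' in Ω \ closedBall x r, edist (f x) (f x') ^ p * ρ δ x x' ∂m ∂m)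
      (𝓝[>] (0:ℝ))) (𝓝[>] (0:ℝ)) = 0 ∧
    ∀ x ∈ Ω,
      Filter.limsup (fun r : ℝ => Filter.limsup (fun δ : ℝ =>
          ∫⁻ x' in Ω \ closedBall x r, edist (f x) (f x') ^ p * ρ δ x x' ∂m)
        (𝓝[>] (0:ℝ))) (𝓝[>] (0:ℝ)) = 0 := by
  obtain ⟨hmeas, hI, hσ, -, -, -, -⟩ := hρ
  obtain ⟨⟨hfm, -⟩, y, hy⟩ := hf
  haveI : SecondCountableTopology X := UniformSpace.secondCountable_of_separable X
  have hp0 : 0 ≤ p := by linarith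
  set C : ℝ≥0∞ := 2 ^ (p - 1) with hC
  have hCt : C ≠ ⊤ := ENNReal.rpow_ne_top_of_nonneg (by linarith) (by simp)
  set g : X → ℝ≥0∞ := Ω.indicator (fun x => edist (f x) y ^ p) with hg
  have hgm : Measurable g := by
    letI : MeasurableSpace Y := borel Y
    haveI : BorelSpace Y := ⟨rfl⟩
    have h1 : Measurable fun x : Ω => edist (f x) y ^ p :=
      ((measurable_edist_left (x := y)).comp hfm).pow_const p
    refine measurable_of_restrict_of_restrict_compl hΩ.measurableSet ?_ ?_
    · convert h1 using 1
      ext x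
      have := indicator_of_mem x.2 (fun x => edist (f x) y ^ p)
      simpa [hg] using this
    · convert (measurable_const : Measurable fun _ : (Ωᶜ : Set X) => (0 : ℝ≥0∞)) using 1
      ext x
      have := indicator_of_notMem x.2 (fun x => edist (f x) y ^ p)
      simpa [hg] using this
  have hG : ∫⁻ x, g x ∂m = ∫⁻ x in Ω, edist (f x) y ^ p ∂m :=
    lintegral_indicator hΩ.measurableSet _
  set G : ℝ≥0∞ := ∫⁻ x, g x ∂m with hGdef
  have hGt : G ≠ ⊤ := by rw [hG]; exact hy.ne
  set κ : ℝ → ℝ → X → X → ℝ≥0∞ := fun r δ x x' =>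
    (closedBall x r)ᶜ.indicator (fun x' => (ρ δ x x' : ℝ≥0∞)) x' with hκ
  have hκm : ∀ r, ∀ δ ∈ Ioo (0:ℝ) 1, Measurable (Function.uncurry (κ r δ)) := by
    intro r δ hδ
    have hs : MeasurableSet {q : X × X | r < dist q.2 q.1} :=
      measurableSet_lt measurable_const (measurable_snd.dist measurable_fst)
    have := (hmeas δ hδ).coe_nnreal_ennreal.indicator hs
    convert this using 1
    ext q
    simp [κ, Function.uncurry, Set.indicator]
  set I : ℝ → ℝ → ℝ≥0∞ := fun r δ =>
    ⨆ x : X, ∫⁻ x' in (closedBall x r)ᶜ, ((ρ δ x x' : ℝ≥0∞) + (ρ δ x' x : ℝ≥0∞)) ∂m with hIdef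
  have hI1 : ∀ r δ x, ∫⁻ x', κ r δ x x' ∂m ≤ I r δ := by
    intro r δ x
    refine le_trans ?_ (le_iSup _ x)
    simp only [κ]
    rw [lintegral_indicator isClosed_closedBall.measurableSet.compl]
    exact lintegral_mono fun x' => le_self_add
  have hI2 : ∀ r δ x', ∫⁻ x, κ r δ x x' ∂m ≤ I r δ := by
    intro r δ x'
    refine le_trans ?_ (le_iSup _ x')
    rw [← lintegral_indicator isClosed_closedBall.measurableSet.compl]
    refine lintegral_mono fun x => ?_
    simp only [κ, Set.indicator, mem_compl_iff, mem_closedBall, dist_comm x x']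
    split_ifs
    · exact le_rfl
    · exact le_add_self
  have hkey : ∀ r, ∀ δ ∈ Ioo (0:ℝ) 1, ∀ x ∈ Ω,
      ∫⁻ x' in Ω \ closedBall x r, edist (f x) (f x') ^ p * ρ δ x x' ∂m ≤
        C * (g x * ∫⁻ x', κ r δ x x' ∂m + ∫⁻ x', g x' * κ r δ x x' ∂m) := by
    intro r δ hδ x hx
    have hkx : Measurable (κ r δ x) := (hκm r δ hδ).comp measurable_prodMk_left
    rw [← lintegral_const_mul _ hkx, ← lintegral_add_left (hkx.const_mul _),
      ← lintegral_const_mul' _ _ hCt,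
      ← lintegral_indicator (hΩ.measurableSet.diff isClosed_closedBall.measurableSet)]
    refine lintegral_mono fun x' => ?_
    by_cases h' : x' ∈ Ω \ closedBall x r
    · rw [indicator_of_mem h']
      have e1 : κ r δ x x' = ρ δ x x' := indicator_of_mem h'.2 _
      have e2 : g x = edist (f x) y ^ p := indicator_of_mem hx _
      have e3 : g x' = edist (f x') y ^ p := indicator_of_mem h'.1 _
      rw [e1, e2, e3, ← add_mul, ← mul_assoc]
      gcongr
      refine le_trans ?_ (ENNReal.rpow_add_le_mul_rpow_add_rpow _ _ hp)
      gcongr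
      exact edist_triangle_right _ _ _
    · rw [indicator_of_notMem h']
      exact zero_le
  have hev : ∀ᶠ δ in 𝓝[>] (0:ℝ), δ ∈ Ioo (0:ℝ) 1 := Ioo_mem_nhdsGT one_pos
  constructor
  · refine limsup2_zero _ I I (C * G) (C * G) (ENNReal.mul_ne_top hCt hGt)
      (ENNReal.mul_ne_top hCt hGt) (fun r => ?_) hI hI
    filter_upwards [hev] with δ hδ
    have hk := hκm r δ hδ
    calc _ ≤ ∫⁻ x in Ω, C * (g x * ∫⁻ x', κ r δ x x' ∂m + ∫⁻ x', g x' * κ r δ x x' ∂m) ∂m :=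
          setLIntegral_mono' hΩ.measurableSet fun x hx => hkey r δ hδ x hx
      _ ≤ ∫⁻ x, C * (g x * ∫⁻ x', κ r δ x x' ∂m + ∫⁻ x', g x' * κ r δ x x' ∂m) ∂m :=
          setLIntegral_le_lintegral _ _
      _ ≤ ∫⁻ x, C * (g x * I r δ + ∫⁻ x', g x' * κ r δ x x' ∂m) ∂m := by
          gcongr with x
          exact hI1 r δ x
      _ = C * (G * I r δ + ∫⁻ x, ∫⁻ x', g x' * κ r δ x x' ∂m ∂m) := by
          rw [lintegral_const_mul' _ _ hCt, lintegral_add_left (hgm.mul_const _),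
            lintegral_mul_const _ hgm]
      _ = C * (G * I r δ + ∫⁻ x', g x' * ∫⁻ x, κ r δ x x' ∂m ∂m) := by
          rw [lintegral_lintegral_swap ((hgm.comp measurable_snd).mul hk).aemeasurable]
          congr 3
          ext x'
          exact lintegral_const_mul _ (hk.comp measurable_prodMk_right)
      _ ≤ C * (G * I r δ + ∫⁻ x', g x' * I r δ ∂m) := by
          gcongr with x'
          exact hI2 r δ x'
      _ = C * G * I r δ + C * G * I r δ := by
          rw [lintegral_mul_const _ hgm]; ring
  · intro x hx
    have hgx : g x ≠ ⊤ := by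
      rw [hg, indicator_of_mem hx]
      exact ENNReal.rpow_ne_top_of_nonneg hp0 (edist_ne_top _ _)
    refine limsup2_zero _ I (fun r δ => sigmaM ρ δ x r) (C * g x) (C * G)
      (ENNReal.mul_ne_top hCt hgx) (ENNReal.mul_ne_top hCt hGt) (fun r => ?_) hI (hσ x)
    filter_upwards [hev] with δ hδ
    refine (hkey r δ hδ x hx).trans ?_
    calc _ ≤ C * (g x * I r δ + ∫⁻ x', g x' * sigmaM ρ δ x r ∂m) := by
          gcongr with x'
          · exact hI1 r δ x
          · by_cases h' : x' ∈ (closedBall x r)ᶜ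
            · simp only [κ]
              rw [indicator_of_mem h']
              exact le_iSup₂ (f := fun x' (_ : x' ∈ (closedBall x r)ᶜ) => (ρ δ x x' : ℝ≥0∞)) x' h'
            · simp only [κ]
              rw [indicator_of_notMem h']
              exact zero_le
      _ = _ := by rw [lintegral_mul_const _ hgm]; ring

end BBM
end
end
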